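/- arXiv:2407.03213 — 2 statements merged into one kernel-verified Lean document; each statement's English description precedes it below -/
import Mathlib

section
/- Double bracket with the drift for the linear port-Hamiltonian problem: Define f_0 : ℝ^n × ℝ → ℝ^n × ℝ by f_0(x,z) = (A x, xᵀ Q G Y Gᵀ Q x) and, for i ∈ {1,…,m}, f_i(x,z) = (g_i, xᵀ Q G n_i + ℓ_i). Then for all i ∈ {1,…,m} and all (x,z) ∈ ℝ^n × ℝ, [f_0, [f_0, f_i]](x,z) = ( A² g_i , n_iᵀ Gᵀ Q A² x − 2 g_iᵀ Q G Y Gᵀ Q A x + 2 xᵀ Q G Y Gᵀ Q A g_i ). -/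
open Matrix

/-- The Lie bracket of two vector fields: `[h,k](x) = Dk(x) h(x) - Dh(x) k(x)`. -/
noncomputable def lieBracket {E : Type*} [NormedAddCommGroup E] [NormedSpace ℝ E]
    (h k : E → E) : E → E :=
  fun x => fderiv ℝ k x (h x) - fderiv ℝ h x (k x)

theorem hasFDerivAt_fst_dotProduct {n : ℕ} (c : Fin n → ℝ) (w : (Fin n → ℝ) × ℝ) :
    HasFDerivAt (fun w : (Fin n → ℝ) × ℝ => w.1 ⬝ᵥ c)
      (∑ j, c j • (ContinuousLinearMap.proj (R := ℝ) (φ := fun _ : Fin n => ℝ) j).comp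
        (ContinuousLinearMap.fst ℝ (Fin n → ℝ) ℝ)) w := by
  convert ContinuousLinearMap.hasFDerivAt (x := w) _ using 1
  ext w
  simp [dotProduct, mul_comm]

theorem hasFDerivAt_mulVec_fst {n : ℕ} (A : Matrix (Fin n) (Fin n) ℝ)
    (w : (Fin n → ℝ) × ℝ) :
    HasFDerivAt (fun w : (Fin n → ℝ) × ℝ => A.mulVec w.1)
      ((LinearMap.toContinuousLinearMap A.mulVecLin).comp
        (ContinuousLinearMap.fst ℝ (Fin n → ℝ) ℝ)) w :=
  ((LinearMap.toContinuousLinearMap A.mulVecLin).comp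
    (ContinuousLinearMap.fst ℝ (Fin n → ℝ) ℝ)).hasFDerivAt

theorem fderiv_linear_quadratic_apply {n : ℕ} (A M : Matrix (Fin n) (Fin n) ℝ) (hM : Mᵀ = M)
    (w v : (Fin n → ℝ) × ℝ) :
    fderiv ℝ (fun w : (Fin n → ℝ) × ℝ => (A.mulVec w.1, w.1 ⬝ᵥ M.mulVec w.1)) w v
      = (A.mulVec v.1, 2 * (w.1 ⬝ᵥ M.mulVec v.1)) := by
  have hfst (j : Fin n) := hasFDerivAt_pi'.1 (hasFDerivAt_fst (𝕜 := ℝ) (p := w)) j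
  have hmul (j : Fin n) := hasFDerivAt_pi'.1 (hasFDerivAt_mulVec_fst M w) j
  have hquad : HasFDerivAt (fun w : (Fin n → ℝ) × ℝ => w.1 ⬝ᵥ M.mulVec w.1) _ w :=
    HasFDerivAt.fun_sum fun j _ => (hfst j).mul (hmul j)
  rw [((hasFDerivAt_mulVec_fst A w).prodMk hquad).fderiv]
  have hsymm : v.1 ⬝ᵥ M.mulVec w.1 = w.1 ⬝ᵥ M.mulVec v.1 := by
    rw [dotProduct_mulVec, ← mulVec_transpose, hM, dotProduct_comm]
  refine Prod.ext (by simp) ?_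
  trans w.1 ⬝ᵥ M.mulVec v.1 + v.1 ⬝ᵥ M.mulVec w.1
  · simp [dotProduct, Finset.sum_add_distrib, mul_comm]
  · rw [hsymm]; ring

theorem lieBracket_linear_quadratic_affine {n : ℕ} (A M : Matrix (Fin n) (Fin n) ℝ)
    (hM : Mᵀ = M) (u c : Fin n → ℝ) (l : ℝ) :
    lieBracket (fun w : (Fin n → ℝ) × ℝ => (A.mulVec w.1, w.1 ⬝ᵥ M.mulVec w.1))
        (fun w => (u, w.1 ⬝ᵥ c + l))
      = fun w => (-A.mulVec u, w.1 ⬝ᵥ (Aᵀ.mulVec c - (2 : ℝ) • M.mulVec u) + 0) := by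
  funext w
  have haffine := (hasFDerivAt_const u w).prodMk ((hasFDerivAt_fst_dotProduct c w).add_const l)
  have hadj : A.mulVec w.1 ⬝ᵥ c = w.1 ⬝ᵥ Aᵀ.mulVec c := by
    rw [mulVec_transpose, dotProduct_comm, dotProduct_mulVec, dotProduct_comm]
  rw [lieBracket, fderiv_linear_quadratic_apply A M hM, haffine.fderiv]
  refine Prod.ext (by simp) ?_
  trans A.mulVec w.1 ⬝ᵥ c - 2 * (w.1 ⬝ᵥ M.mulVec u)
  · simp [dotProduct, mul_comm]
  · simp [hadj, dotProduct_sub, dotProduct_smul]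

/-- Double bracket with the drift for the linear port-Hamiltonian
problem. -/
theorem linear_pH_double_bracket_drift
    (n m : ℕ)
    (A : Matrix (Fin n) (Fin n) ℝ)
    (Q : Matrix (Fin n) (Fin n) ℝ) (hQsym : Qᵀ = Q)
    (Y : Matrix (Fin m) (Fin m) ℝ) (hYsym : Yᵀ = Y)
    (G : Matrix (Fin n) (Fin m) ℝ) (N : Matrix (Fin m) (Fin m) ℝ)
    (g : Fin m → Fin n → ℝ) (hg : ∀ i, g i = fun r => G r i)
    (nv : Fin m → Fin m → ℝ) (hnv : ∀ i, nv i = fun r => N r i)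
    (l : Fin m → ℝ)
    (f0 : ((Fin n → ℝ) × ℝ) → ((Fin n → ℝ) × ℝ))
    (hf0 : f0 = fun w => (A.mulVec w.1, w.1 ⬝ᵥ (Q * G * Y * Gᵀ * Q).mulVec w.1))
    (f : Fin m → ((Fin n → ℝ) × ℝ) → ((Fin n → ℝ) × ℝ))
    (hf : ∀ i, f i = fun w => (g i, w.1 ⬝ᵥ (Q * G).mulVec (nv i) + l i)) :
    ∀ i : Fin m, ∀ w : (Fin n → ℝ) × ℝ,
      lieBracket f0 (lieBracket f0 (f i)) w
        = ((A * A).mulVec (g i),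
            nv i ⬝ᵥ (Gᵀ * Q * (A * A)).mulVec w.1
              - 2 * (g i ⬝ᵥ (Q * G * Y * Gᵀ * Q * A).mulVec w.1)
              + 2 * (w.1 ⬝ᵥ (Q * G * Y * Gᵀ * Q * A).mulVec (g i))) := by
  intro i w
  have hM : (Q * G * Y * Gᵀ * Q)ᵀ = Q * G * Y * Gᵀ * Q := by
    simp [Matrix.transpose_mul, hQsym, hYsym, Matrix.mul_assoc]
  rw [hf0, hf i, lieBracket_linear_quadratic_affine A _ hM,
    lieBracket_linear_quadratic_affine A _ hM]
  have hlin : nv i ⬝ᵥ (Gᵀ * Q * (A * A)).mulVec w.1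
      = w.1 ⬝ᵥ Aᵀ.mulVec (Aᵀ.mulVec ((Q * G).mulVec (nv i))) := by
    rw [dotProduct_mulVec, ← mulVec_transpose, dotProduct_comm]
    simp [Matrix.transpose_mul, hQsym, Matrix.mul_assoc]
  have hquad : g i ⬝ᵥ (Q * G * Y * Gᵀ * Q * A).mulVec w.1
      = w.1 ⬝ᵥ Aᵀ.mulVec ((Q * G * Y * Gᵀ * Q).mulVec (g i)) := by
    rw [dotProduct_mulVec, ← mulVec_transpose, dotProduct_comm, Matrix.transpose_mul, hM,
      mulVec_mulVec]
  rw [hlin, hquad]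
  refine Prod.ext (by simp [mulVec_neg]) ?_
  simp only [mulVec_sub, mulVec_smul, mulVec_neg, dotProduct_sub, dotProduct_smul,
    dotProduct_neg, smul_eq_mul, mulVec_mulVec]
  ring
end

section
/- Second derivative of the switching function in the case N = I_m: Let J, R, Q ∈ ℝ^{n×n} with J skew-symmetric, R symmetric, Q symmetric, Y ∈ ℝ^{n×n} symmetric, G ∈ ℝ^{n×m} with columns g_1, …, g_m, and set A := (J − R) Q. Let u : I → ℝ^m be continuous on an open interval I, and let x, p : I → ℝ^n be differentiable with x'(t) = A x(t) + G u(t) and p'(t) = −Aᵀ p(t) − 2 Q G Y Gᵀ Q x(t) − Q G u(t) for all t ∈ I (the adjoint equation with N = I_m). For i ∈ {1,…,m}, define s_i(t) := p(t)ᵀ g_i + x(t)ᵀ Q g_i + ℓ_i. Then s_i is twice differentiable on I and for all t ∈ I: s_i''(t) = p(t)ᵀ A² g_i + x(t)ᵀ [2 Q G Y Gᵀ Q (J − R) Q − 2 Aᵀ Q G Y Gᵀ Q + (Aᵀ)² Q] g_i − 2 u(t)ᵀ Gᵀ Q (R + G Y Gᵀ) Q g_i. -/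
open Matrix

theorem Matrix.mulVec_dotProduct_eq_transpose {α β S : Type*} [Fintype α] [Fintype β]
    [CommSemiring S] (B : Matrix α β S) (v : β → S) (w : α → S) :
    B.mulVec v ⬝ᵥ w = v ⬝ᵥ Bᵀ.mulVec w := by
  rw [dotProduct_comm, dotProduct_mulVec, dotProduct_comm, mulVec_transpose]

theorem HasDerivAt.dotProduct_const {ι : Type*} [Fintype ι] {f : ℝ → ι → ℝ} {f' : ι → ℝ}
    {t : ℝ} (hf : HasDerivAt f f' t) (w : ι → ℝ) :
    HasDerivAt (fun τ => f τ ⬝ᵥ w) (f' ⬝ᵥ w) t := by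
  unfold dotProduct
  exact HasDerivAt.fun_sum fun j _ => (hasDerivAt_pi.1 hf j).mul_const (w j)

/-- Second derivative of the switching function in the case `N = I_m`. -/
theorem switching_function_second_derivative_N_id
    (n m : ℕ)
    (J R Q : Matrix (Fin n) (Fin n) ℝ)
    (hJskew : Jᵀ = -J) (hRsym : Rᵀ = R) (hQsym : Qᵀ = Q)
    (Y : Matrix (Fin m) (Fin m) ℝ) (hYsym : Yᵀ = Y)
    (G : Matrix (Fin n) (Fin m) ℝ)
    (g : Fin m → Fin n → ℝ) (hg : ∀ i, g i = fun r => G r i)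
    (l : Fin m → ℝ)
    (A : Matrix (Fin n) (Fin n) ℝ) (hA : A = (J - R) * Q)
    (a b : ℝ) (u : ℝ → Fin m → ℝ) (hu : ContinuousOn u (Set.Ioo a b))
    (x p : ℝ → Fin n → ℝ)
    (hx : ∀ t ∈ Set.Ioo a b, HasDerivAt x (A.mulVec (x t) + G.mulVec (u t)) t)
    (hp : ∀ t ∈ Set.Ioo a b, HasDerivAt p
      (-(Aᵀ.mulVec (p t)) - (2 : ℝ) • (Q * G * Y * Gᵀ * Q).mulVec (x t)
        - (Q * G).mulVec (u t)) t) :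
    ∀ i : Fin m, ∃ s' : ℝ → ℝ,
      (∀ t ∈ Set.Ioo a b,
        HasDerivAt (fun τ => p τ ⬝ᵥ g i + x τ ⬝ᵥ Q.mulVec (g i) + l i) (s' t) t)
      ∧ (∀ t ∈ Set.Ioo a b,
          HasDerivAt s'
            (p t ⬝ᵥ (A * A).mulVec (g i)
              + x t ⬝ᵥ ((2 : ℝ) • (Q * G * Y * Gᵀ * Q * (J - R) * Q)
                  - (2 : ℝ) • (Aᵀ * Q * G * Y * Gᵀ * Q)
                  + Aᵀ * Aᵀ * Q).mulVec (g i)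
              - 2 * (u t ⬝ᵥ (Gᵀ * Q * (R + G * Y * Gᵀ) * Q).mulVec (g i))) t) := by
  intro i
  have hM : (Q * G * Y * Gᵀ * Q)ᵀ = Q * G * Y * Gᵀ * Q := by
    simp only [transpose_mul, transpose_transpose, hQsym, hYsym, Matrix.mul_assoc]
  have hAt : Aᵀ * Q = -(Q * (J + R) * Q) := by
    rw [hA, transpose_mul, transpose_sub, hJskew, hRsym, hQsym]
    noncomm_ring
  refine ⟨fun τ => x τ ⬝ᵥ (Aᵀ * Q - (2 : ℝ) • (Q * G * Y * Gᵀ * Q)).mulVec (g i)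
    - p τ ⬝ᵥ A.mulVec (g i), fun t ht => ?_, fun t ht => ?_⟩
  · refine ((((hp t ht).dotProduct_const (g i)).add
      ((hx t ht).dotProduct_const (Q.mulVec (g i)))).add_const (l i)).congr_deriv ?_
    simp only [sub_dotProduct, add_dotProduct, neg_dotProduct, smul_dotProduct,
      mulVec_dotProduct_eq_transpose, hM, transpose_transpose, sub_mulVec, smul_mulVec,
      dotProduct_sub, dotProduct_smul, mulVec_mulVec, transpose_mul Q G, hQsym]
    ring
  · refine (((hx t ht).dotProduct_const _).sub
      ((hp t ht).dotProduct_const (A.mulVec (g i)))).congr_deriv ?_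
    have hxcoef : (2 : ℝ) • (Q * G * Y * Gᵀ * Q * (J - R) * Q)
          - (2 : ℝ) • (Aᵀ * Q * G * Y * Gᵀ * Q) + Aᵀ * Aᵀ * Q
        = Aᵀ * (Aᵀ * Q - (2 : ℝ) • (Q * G * Y * Gᵀ * Q))
          + (2 : ℝ) • (Q * G * Y * Gᵀ * Q * A) := by
      rw [Matrix.mul_assoc _ (J - R) Q, ← hA]
      simp only [Matrix.mul_sub, Matrix.mul_smul, Matrix.mul_assoc]
      abel
    have hucoef : Gᵀ * (Aᵀ * Q - (2 : ℝ) • (Q * G * Y * Gᵀ * Q)) + Gᵀ * Q * A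
        = -((2 : ℝ) • (Gᵀ * Q * (R + G * Y * Gᵀ) * Q)) := by
      rw [hAt, hA]
      simp only [Matrix.mul_sub, Matrix.sub_mul, Matrix.mul_add, Matrix.add_mul,
        Matrix.mul_neg, Matrix.mul_assoc, two_smul]
      abel
    have hu' := congrArg (fun B => u t ⬝ᵥ B.mulVec (g i)) hucoef
    simp only [add_mulVec, neg_mulVec, smul_mulVec, dotProduct_add, dotProduct_neg,
      dotProduct_smul, smul_eq_mul] at hu'
    rw [hxcoef]
    simp only [sub_dotProduct, add_dotProduct, neg_dotProduct, smul_dotProduct,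
      mulVec_dotProduct_eq_transpose, hM, transpose_transpose, add_mulVec, smul_mulVec,
      dotProduct_add, dotProduct_smul, mulVec_mulVec, transpose_mul Q G, hQsym, smul_eq_mul]
    linarith
end
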